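/- arXiv:1511.06682 — 8 statements merged into one kernel-verified Lean document; each statement's English description precedes it below -/
import Mathlib

section
/- Let G be a group acting on the left on a set M, and let Hor ⊆ M × M be a discrete connection on the G-set M with discrete connection form Ad. Then for all g₀, g₁ ∈ G and all m₀, m₁ ∈ M one has Ad(g₀ • m₀, g₁ • m₁) = g₁ · Ad(m₀, m₁) · g₀⁻¹. (In particular, taking g₀ = g₁ = g, Ad is equivariant for the diagonal G-action on M × M and the conjugation action on G.) -/
/-- A discrete connection on the `G`-set `M`. -/
structure DiscreteConnection (G M : Type*) [Group G] [MulAction G M] where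
  Hor : Set (M × M)
  invariant : ∀ (g : G) (m₀ m₁ : M), (m₀, m₁) ∈ Hor → (g • m₀, g • m₁) ∈ Hor
  Ad : M × M → G
  mem_hor_Ad : ∀ m₀ m₁ : M, (m₀, (Ad (m₀, m₁))⁻¹ • m₁) ∈ Hor
  Ad_unique : ∀ (m₀ m₁ : M) (g : G), (m₀, g⁻¹ • m₁) ∈ Hor → g = Ad (m₀, m₁)
  hd : M → Quotient (MulAction.orbitRel G M) → M
  mem_hor_hd : ∀ (m₀ : M) (r : Quotient (MulAction.orbitRel G M)), (m₀, hd m₀ r) ∈ Hor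
  orbit_hd : ∀ (m₀ : M) (r : Quotient (MulAction.orbitRel G M)),
    Quotient.mk (MulAction.orbitRel G M) (hd m₀ r) = r
  hd_unique : ∀ (m₀ m₁ : M) (r : Quotient (MulAction.orbitRel G M)),
    (m₀, m₁) ∈ Hor → Quotient.mk (MulAction.orbitRel G M) m₁ = r → m₁ = hd m₀ r


/-- The discrete connection form is `G × G`-equivariant:
`Ad(g₀ • m₀, g₁ • m₁) = g₁ · Ad(m₀, m₁) · g₀⁻¹`.  In particular (taking `g₀ = g₁`), `Ad` is
equivariant for the diagonal `G`-action on `M × M` and the conjugation action on `G`. -/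
theorem discreteConnection_Ad_equivariant {G M : Type*} [Group G] [MulAction G M]
    (D : DiscreteConnection G M) (g₀ g₁ : G) (m₀ m₁ : M) :
    D.Ad (g₀ • m₀, g₁ • m₁) = g₁ * D.Ad (m₀, m₁) * g₀⁻¹ := by
  refine (D.Ad_unique _ _ _ ?_).symm
  simpa [mul_smul] using D.invariant g₀ _ _ (D.mem_hor_Ad m₀ m₁)
end

section
/- Let G act on the left on sets E and M, let φ : E → M be G-equivariant, and let Hor ⊆ M × M be a discrete connection on the G-set M with form Ad and horizontal lift hd. Define Φ̃ : E × M → E × G × (M/G) by Φ̃(ε, m) := (ε, Ad(φ(ε), m), ⟦m⟧) and Ψ̃ : E × G × (M/G) → E × M by Ψ̃(ε, w, r) := (ε, w • hd(φ(ε), r)). Then Φ̃ and Ψ̃ are mutually inverse bijections, and Φ̃ is G-equivariant: Φ̃(g • ε, g • m) = (g • ε, g · Ad(φ(ε), m) · g⁻¹, ⟦m⟧) for all g ∈ G. -/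
/-- `Φ̃ : E × M → E × G × (M/G)`, `Φ̃(ε, m) = (ε, Ad(φ(ε), m), ⟦m⟧)`. -/
def PhiTilde {G E M : Type*} [Group G] [MulAction G E] [MulAction G M]
    (φ : E → M) (D : DiscreteConnection G M) :
    E × M → E × G × Quotient (MulAction.orbitRel G M) :=
  fun p => (p.1, D.Ad (φ p.1, p.2), Quotient.mk (MulAction.orbitRel G M) p.2)

/-- `Ψ̃ : E × G × (M/G) → E × M`, `Ψ̃(ε, w, r) = (ε, w • hd(φ(ε), r))`. -/
def PsiTilde {G E M : Type*} [Group G] [MulAction G E] [MulAction G M]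
    (φ : E → M) (D : DiscreteConnection G M) :
    E × G × Quotient (MulAction.orbitRel G M) → E × M :=
  fun q => (q.1, q.2.1 • D.hd (φ q.1) q.2.2)

/-- Translating by a group element does not change the orbit. -/
theorem quotient_mk_smul {G M : Type*} [Group G] [MulAction G M] (g : G) (m : M) :
    Quotient.mk (MulAction.orbitRel G M) (g • m) = Quotient.mk (MulAction.orbitRel G M) m :=
  Quotient.sound (MulAction.orbitRel_apply.mpr (MulAction.mem_orbit m g))

namespace DiscreteConnection

variable {G M : Type*} [Group G] [MulAction G M] (D : DiscreteConnection G M)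

theorem Ad_smul_hd (m₀ m₁ : M) :
    D.Ad (m₀, m₁) • D.hd m₀ (Quotient.mk (MulAction.orbitRel G M) m₁) = m₁ := by
  rw [← D.hd_unique m₀ _ _ (D.mem_hor_Ad m₀ m₁) (quotient_mk_smul _ m₁), smul_inv_smul]

theorem Ad_smul_hd_right (m₀ : M) (w : G) (r : Quotient (MulAction.orbitRel G M)) :
    D.Ad (m₀, w • D.hd m₀ r) = w := by
  refine (D.Ad_unique _ _ _ ?_).symm
  rw [inv_smul_smul]
  exact D.mem_hor_hd m₀ r

theorem Ad_smul_smul (g : G) (m₀ m₁ : M) :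
    D.Ad (g • m₀, g • m₁) = g * D.Ad (m₀, m₁) * g⁻¹ := by
  refine (D.Ad_unique _ _ _ ?_).symm
  simpa [mul_smul] using D.invariant g _ _ (D.mem_hor_Ad m₀ m₁)

end DiscreteConnection

/-- `Φ̃` and `Ψ̃` are mutually inverse bijections and `Φ̃` is `G`-equivariant:
`Φ̃(g • ε, g • m) = (g • ε, g · Ad(φ(ε), m) · g⁻¹, ⟦m⟧)`. -/
theorem phiTilde_psiTilde_inverse_equivariant {G E M : Type*} [Group G] [MulAction G E]
    [MulAction G M] (φ : E → M) (hφ : ∀ (g : G) (ε : E), φ (g • ε) = g • φ ε)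
    (D : DiscreteConnection G M) :
    Function.LeftInverse (PsiTilde φ D) (PhiTilde φ D) ∧
    Function.RightInverse (PsiTilde φ D) (PhiTilde φ D) ∧
    (∀ (g : G) (ε : E) (m : M),
      PhiTilde φ D (g • ε, g • m) =
        (g • ε, g * D.Ad (φ ε, m) * g⁻¹, Quotient.mk (MulAction.orbitRel G M) m)) := by
  refine ⟨fun p => ?_, fun q => ?_, fun g ε m => ?_⟩
  · simp only [PsiTilde, PhiTilde, D.Ad_smul_hd]
  · simp only [PsiTilde, PhiTilde, D.Ad_smul_hd_right, quotient_mk_smul, D.orbit_hd]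
  · simp only [PhiTilde, hφ, D.Ad_smul_smul, quotient_mk_smul]
end

section
/- Let G act on the left on sets E and M with the action on M free, let φ : E → M be G-equivariant, let Hor ⊆ M × M be a discrete connection on the G-set M with form Ad and horizontal lift hd, and let Υ : E × M → G̃_E × (M/G) and p : G̃_E → M/G be the induced maps. Suppose (v₀, r₁), (v₁, r₂) ∈ G̃_E × (M/G) satisfy p(v₁) = r₁, and (ε₀, m₁) ∈ E × M satisfies Υ(ε₀, m₁) = (v₀, r₁). Then there exists a unique pair (ε₁, m₂) ∈ E × M such that φ(ε₁) = m₁ and Υ(ε₁, m₂) = (v₁, r₂). -/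
/-- The total space of the conjugate bundle: pairs `(ε, w) ∈ E × G` with the
`G`-action `g • (ε, w) = (g • ε, g w g⁻¹)`. -/
structure ConjPair (E G : Type*) where
  base : E
  grp : G

instance ConjPair.instSMul {G E : Type*} [Group G] [MulAction G E] : SMul G (ConjPair E G) :=
  ⟨fun g p => ⟨g • p.base, g * p.grp * g⁻¹⟩⟩

theorem ConjPair.smul_def {G E : Type*} [Group G] [MulAction G E] (g : G) (p : ConjPair E G) :
    g • p = ⟨g • p.base, g * p.grp * g⁻¹⟩ := rfl

instance ConjPair.instMulAction {G E : Type*} [Group G] [MulAction G E] :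
    MulAction G (ConjPair E G) where
  one_smul p := by simp [ConjPair.smul_def]
  mul_smul g h p := by simp [ConjPair.smul_def, mul_smul, mul_assoc]

/-- The map `Υ : E × M → G̃_E × (M/G)` induced by a discrete connection. -/
def Upsilon {G E M : Type*} [Group G] [MulAction G E] [MulAction G M]
    (φ : E → M) (D : DiscreteConnection G M) :
    E × M →
      Quotient (MulAction.orbitRel G (ConjPair E G)) × Quotient (MulAction.orbitRel G M) :=
  fun p =>
    (Quotient.mk (MulAction.orbitRel G (ConjPair E G)) ⟨p.1, D.Ad (φ p.1, p.2)⟩,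
     Quotient.mk (MulAction.orbitRel G M) p.2)

/-- The projection `p : G̃_E → M/G`, `p ⟦(ε, w)⟧ = ⟦φ ε⟧`. -/
def conjProj {G E M : Type*} [Group G] [MulAction G E] [MulAction G M]
    (φ : E → M) (hφ : ∀ (g : G) (ε : E), φ (g • ε) = g • φ ε) :
    Quotient (MulAction.orbitRel G (ConjPair E G)) → Quotient (MulAction.orbitRel G M) :=
  Quotient.lift (fun p : ConjPair E G => Quotient.mk (MulAction.orbitRel G M) (φ p.base))
    (by
      intro p q hpq
      obtain ⟨g, hg⟩ := MulAction.mem_orbit_iff.mp hpq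
      subst hg
      apply Quotient.sound
      exact MulAction.mem_orbit_iff.mpr ⟨g, (hφ g q.base).symm⟩)

/-- A pair is determined by its first entry, its discrete connection form and the orbit of its
second entry: these force the second entry to be the translated horizontal lift. -/
theorem DiscreteConnection.ad_eq_and_orbit_eq_iff {G M : Type*} [Group G] [MulAction G M]
    (D : DiscreteConnection G M) (m₀ m₁ : M) (g : G)
    (r : Quotient (MulAction.orbitRel G M)) :
    D.Ad (m₀, m₁) = g ∧ Quotient.mk (MulAction.orbitRel G M) m₁ = r ↔ m₁ = g • D.hd m₀ r := by
  have mk_smul (h : G) (m : M) : Quotient.mk (MulAction.orbitRel G M) (h • m) =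
      Quotient.mk (MulAction.orbitRel G M) m :=
    Quotient.sound ⟨h, rfl⟩
  constructor
  · rintro ⟨rfl, rfl⟩
    rw [← D.hd_unique m₀ _ _ (D.mem_hor_Ad m₀ m₁) (mk_smul _ _), smul_inv_smul]
  · rintro rfl
    refine ⟨(D.Ad_unique _ _ _ ?_).symm, (mk_smul _ _).trans (D.orbit_hd m₀ r)⟩
    rw [inv_smul_smul]
    exact D.mem_hor_hd m₀ r

/-- When `M` is free, a class in `G̃_E` has at most one representative over a given point. -/
theorem ConjPair.eq_of_mk_eq {G E M : Type*} [Group G] [MulAction G E] [MulAction G M]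
    (hfree : ∀ (g : G) (m : M), g • m = m → g = 1)
    (φ : E → M) (hφ : ∀ (g : G) (ε : E), φ (g • ε) = g • φ ε) {p q : ConjPair E G}
    (hbase : φ p.base = φ q.base)
    (h : Quotient.mk (MulAction.orbitRel G (ConjPair E G)) p = Quotient.mk _ q) : p = q := by
  obtain ⟨g, rfl⟩ := Quotient.exact h
  have hg : g = 1 := hfree g (φ q.base) ((hφ g q.base).symm.trans hbase)
  subst hg
  exact one_smul G q

/-- A class in `G̃_E` has a representative over each point of the orbit it projects to. -/
theorem ConjPair.exists_rep_over {G E M : Type*} [Group G] [MulAction G E] [MulAction G M]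
    (φ : E → M) (hφ : ∀ (g : G) (ε : E), φ (g • ε) = g • φ ε)
    (v : Quotient (MulAction.orbitRel G (ConjPair E G))) (m : M)
    (h : conjProj φ hφ v = Quotient.mk _ m) :
    ∃ p : ConjPair E G, φ p.base = m ∧ Quotient.mk _ p = v := by
  induction v using Quotient.inductionOn with
  | h p =>
    obtain ⟨g, rfl⟩ := Quotient.exact h.symm
    exact ⟨g • p, hφ g p.base, Quotient.sound ⟨g, rfl⟩⟩

/-- Unique one-step lifting: if `p(v₁) = r₁` and `Υ(ε₀, m₁) = (v₀, r₁)`, then there is a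
unique `(ε₁, m₂) ∈ E × M` with `φ(ε₁) = m₁` and `Υ(ε₁, m₂) = (v₁, r₂)`. -/
theorem upsilon_unique_lift_step {G E M : Type*} [Group G] [MulAction G E] [MulAction G M]
    (hfree : ∀ (g : G) (m : M), g • m = m → g = 1)
    (φ : E → M) (hφ : ∀ (g : G) (ε : E), φ (g • ε) = g • φ ε)
    (D : DiscreteConnection G M)
    (v₀ v₁ : Quotient (MulAction.orbitRel G (ConjPair E G)))
    (r₁ r₂ : Quotient (MulAction.orbitRel G M))
    (hp : conjProj φ hφ v₁ = r₁)
    (ε₀ : E) (m₁ : M) (hΥ : Upsilon φ D (ε₀, m₁) = (v₀, r₁)) :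
    ∃! q : E × M, φ q.1 = m₁ ∧ Upsilon φ D q = (v₁, r₂) := by
  have hr : Quotient.mk _ m₁ = r₁ := congrArg Prod.snd hΥ
  obtain ⟨⟨ε, w⟩, hε, rfl⟩ := ConjPair.exists_rep_over φ hφ v₁ m₁ (hp.trans hr.symm)
  dsimp only at hε
  subst hε
  refine ⟨(ε, w • D.hd (φ ε) r₂), ⟨rfl, ?_⟩, ?_⟩
  · obtain ⟨hAd, horb⟩ := (D.ad_eq_and_orbit_eq_iff (φ ε) _ w r₂).mpr rfl
    simp only [Upsilon, hAd, horb]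
  · rintro ⟨ε', m'⟩ ⟨hε', hq⟩
    obtain ⟨hv, horb⟩ := Prod.mk.inj hq
    obtain ⟨rfl, hAd⟩ := ConjPair.mk.inj (ConjPair.eq_of_mk_eq hfree φ hφ hε' hv)
    rw [(D.ad_eq_and_orbit_eq_iff (φ ε') m' w r₂).mp ⟨hAd, horb⟩]
end

section
/- Let G act on the left on sets E and M with the action on M free, let φ : E → M be G-equivariant, let Hor ⊆ M × M be a discrete connection on the G-set M, and let Υ : E × M → G̃_E × (M/G) and p : G̃_E → M/G be the induced maps. Let N ≥ 1 and let (v₀, r₁), …, (v_{N−1}, r_N) be a discrete path in G̃_E × (M/G), i.e. p(v_k) = r_k for k = 1, …, N−1. Let (ε̃₀, m̃₁) ∈ E × M satisfy Υ(ε̃₀, m̃₁) = (v₀, r₁). Then there is a unique sequence (ε₀, m₁), …, (ε_{N−1}, m_N) in E × M with (ε₀, m₁) = (ε̃₀, m̃₁), φ(ε_{k+1}) = m_{k+1} for k = 0, …, N−2, and Υ(ε_k, m_{k+1}) = (v_k, r_{k+1}) for k = 0, …, N−1. -/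
/-- `Υ` attains every value `(v, r)` over any prescribed base point `m` above `p v`. -/
theorem exists_upsilon_eq {G E M : Type*} [Group G] [MulAction G E] [MulAction G M]
    (φ : E → M) (hφ : ∀ (g : G) (ε : E), φ (g • ε) = g • φ ε)
    (D : DiscreteConnection G M)
    (v : Quotient (MulAction.orbitRel G (ConjPair E G)))
    (r : Quotient (MulAction.orbitRel G M)) (m : M)
    (hm : conjProj φ hφ v = Quotient.mk (MulAction.orbitRel G M) m) :
    ∃ x : E × M, φ x.1 = m ∧ Upsilon φ D x = (v, r) := by
  induction v using Quotient.inductionOn with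
  | h p =>
    obtain ⟨g, rfl⟩ := MulAction.mem_orbit_iff.mp (Quotient.exact hm.symm)
    set w := (g • p).grp
    have hAd : D.Ad (g • φ p.base, w • D.hd (g • φ p.base) r) = w :=
      (D.Ad_unique _ _ w (by rw [inv_smul_smul]; exact D.mem_hor_hd _ r)).symm
    refine ⟨(g • p.base, w • D.hd (g • φ p.base) r), hφ g p.base, Prod.ext ?_ ?_⟩
    · refine Quotient.sound (MulAction.mem_orbit_iff.mpr ⟨g, ?_⟩)
      rw [hφ, hAd]
      rfl
    · refine Eq.trans (Quotient.sound ?_) (D.orbit_hd (g • φ p.base) r)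
      exact MulAction.mem_orbit_iff.mpr ⟨w, rfl⟩

/-- If the action on `M` is free, `Υ` is injective on pairs with the same base point. -/
theorem upsilon_eq_of_base_eq {G E M : Type*} [Group G] [MulAction G E] [MulAction G M]
    (hfree : ∀ (g : G) (m : M), g • m = m → g = 1)
    (φ : E → M) (hφ : ∀ (g : G) (ε : E), φ (g • ε) = g • φ ε)
    (D : DiscreteConnection G M) {x y : E × M}
    (hbase : φ x.1 = φ y.1) (h : Upsilon φ D x = Upsilon φ D y) : x = y := by
  obtain ⟨ε, m⟩ := x
  obtain ⟨ε', m'⟩ := y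
  obtain ⟨h₁, h₂⟩ := Prod.ext_iff.mp h
  obtain ⟨g, hg⟩ := MulAction.mem_orbit_iff.mp (Quotient.exact h₁)
  dsimp only at hbase hg
  have hε : g • ε' = ε := congrArg ConjPair.base hg
  obtain rfl : g = 1 := hfree g (φ ε') (by rw [← hφ, hε, hbase])
  rw [one_smul] at hg hε
  subst hε
  have hAd : D.Ad (φ ε', m') = D.Ad (φ ε', m) := congrArg ConjPair.grp hg
  have horb : ∀ (a : G) (z : M),
      Quotient.mk (MulAction.orbitRel G M) (a • z) = Quotient.mk (MulAction.orbitRel G M) z :=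
    fun a z => Quotient.sound (MulAction.mem_orbit_iff.mpr ⟨a, rfl⟩)
  have e₁ := D.hd_unique _ _ _ (D.mem_hor_Ad (φ ε') m) (horb _ m)
  have e₂ := D.hd_unique _ _ _ (D.mem_hor_Ad (φ ε') m') ((horb _ m').trans h₂.symm)
  rw [hAd] at e₂
  rw [smul_left_cancel _ (e₁.trans e₂.symm)]

/-- Unique lifting of discrete paths: every discrete path `(v₀, r₁), …, (v_{N-1}, r_N)` in
`G̃_E × (M/G)` together with a lift `(ε̃₀, m̃₁)` of its first point lifts uniquely to a
discrete path in `E × M`. The `k`-th entry of `ρ` models the pair `(ε_k, m_{k+1})`. -/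
theorem upsilon_unique_path_lift {G E M : Type*} [Group G] [MulAction G E] [MulAction G M]
    (hfree : ∀ (g : G) (m : M), g • m = m → g = 1)
    (φ : E → M) (hφ : ∀ (g : G) (ε : E), φ (g • ε) = g • φ ε)
    (D : DiscreteConnection G M)
    (N : ℕ) (hN : 1 ≤ N)
    (v : Fin N → Quotient (MulAction.orbitRel G (ConjPair E G)))
    (r : Fin N → Quotient (MulAction.orbitRel G M))
    (hpath : ∀ (k : ℕ) (hk : k + 1 < N), conjProj φ hφ (v ⟨k + 1, hk⟩) = r ⟨k, by omega⟩)
    (ε₀ : E) (m₁ : M)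
    (hstart : Upsilon φ D (ε₀, m₁) = (v ⟨0, hN⟩, r ⟨0, hN⟩)) :
    ∃! ρ : Fin N → E × M,
      ρ ⟨0, hN⟩ = (ε₀, m₁) ∧
      (∀ (k : ℕ) (hk : k + 1 < N), φ (ρ ⟨k + 1, hk⟩).1 = (ρ ⟨k, by omega⟩).2) ∧
      (∀ k : Fin N, Upsilon φ D (ρ k) = (v k, r k)) := by
  have step : ∀ (k : ℕ) (x : E × M), ∃ y : E × M, ∀ hk : k + 1 < N,
      Upsilon φ D x = (v ⟨k, by omega⟩, r ⟨k, by omega⟩) →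
        φ y.1 = x.2 ∧ Upsilon φ D y = (v ⟨k + 1, hk⟩, r ⟨k + 1, hk⟩) := by
    intro k x
    by_cases h : ∃ hk : k + 1 < N, Upsilon φ D x = (v ⟨k, by omega⟩, r ⟨k, by omega⟩)
    · obtain ⟨hk, hx⟩ := h
      obtain ⟨y, hy⟩ := exists_upsilon_eq φ hφ D (v ⟨k + 1, hk⟩) (r ⟨k + 1, hk⟩) x.2
        ((hpath k hk).trans (congrArg Prod.snd hx).symm)
      exact ⟨y, fun _ _ => hy⟩
    · exact ⟨x, fun hk hx => absurd ⟨hk, hx⟩ h⟩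
  choose next hnext using step
  let σ : ℕ → E × M := fun n => Nat.rec (ε₀, m₁) next n
  have hσ : ∀ (k : ℕ) (hk : k < N), Upsilon φ D (σ k) = (v ⟨k, hk⟩, r ⟨k, hk⟩) := by
    intro k
    induction k with
    | zero => exact fun _ => hstart
    | succ k ih => exact fun hk => (hnext k (σ k) hk (ih (by omega))).2
  refine ⟨fun k => σ k, ⟨rfl, fun k hk => (hnext k (σ k) hk (hσ k (by omega))).1,
    fun k => hσ k k.isLt⟩, ?_⟩
  rintro ρ ⟨hρ₀, hρφ, hρ⟩
  have key : ∀ (k : ℕ) (hk : k < N), ρ ⟨k, hk⟩ = σ k := by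
    intro k
    induction k with
    | zero => exact fun _ => hρ₀
    | succ k ih =>
      intro hk
      refine upsilon_eq_of_base_eq hfree φ hφ D ?_ ((hρ _).trans (hσ _ hk).symm)
      rw [hρφ k hk, ih (by omega)]
      exact (hnext k (σ k) hk (hσ k (by omega))).1.symm
  exact funext fun k => key k k.isLt
end

section
/- Let G act on the left on sets E and M, let φ : E → M be G-equivariant, and let Hor₁ and Hor₂ be two discrete connections on the G-set M, with induced maps Υ₁, Υ₂ : E × M → G̃_E × (M/G). Then there exists a unique bijection F : G̃_E × (M/G) → G̃_E × (M/G) such that F ∘ Υ₁ = Υ₂. -/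
namespace DiscreteConnection

variable {G M : Type*} [Group G] [MulAction G M] (D : DiscreteConnection G M)

theorem hd_smul (g : G) (m₀ : M) (r : Quotient (MulAction.orbitRel G M)) :
    D.hd (g • m₀) r = g • D.hd m₀ r := by
  refine (D.hd_unique _ _ _ (D.invariant g _ _ (D.mem_hor_hd m₀ r)) ?_).symm
  conv_rhs => rw [← D.orbit_hd m₀ r]
  exact Quotient.sound ⟨g, rfl⟩

end DiscreteConnection

section Upsilon

variable {G E M : Type*} [Group G] [MulAction G E] [MulAction G M] {φ : E → M}

theorem Upsilon_surjective (φ : E → M) (D : DiscreteConnection G M) :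
    Function.Surjective (Upsilon φ D) := by
  rintro ⟨⟨ε, w⟩, r⟩
  refine ⟨(ε, w • D.hd (φ ε) r), Prod.ext ?_ ?_⟩
  · simp only [Upsilon, D.Ad_smul_hd_right]
    rfl
  · refine Eq.trans ?_ (D.orbit_hd (φ ε) r)
    exact Quotient.sound ⟨w, rfl⟩

theorem Upsilon_eq_iff (hφ : ∀ (g : G) (ε : E), φ (g • ε) = g • φ ε)
    (D : DiscreteConnection G M) (p q : E × M) :
    Upsilon φ D p = Upsilon φ D q ↔ ∃ g : G, g • q = p := by
  obtain ⟨ε, m⟩ := p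
  obtain ⟨ε', m'⟩ := q
  constructor
  · intro h
    obtain ⟨h₁, h₂⟩ := Prod.ext_iff.1 h
    obtain ⟨g, hg⟩ := Quotient.exact h₁
    obtain ⟨rfl, hw⟩ := (ConjPair.mk.injEq _ _ _ _).mp hg
    refine ⟨g, Prod.ext rfl ?_⟩
    change Quotient.mk (MulAction.orbitRel G M) m = Quotient.mk (MulAction.orbitRel G M) m' at h₂
    change g * D.Ad (φ ε', m') * g⁻¹ = D.Ad (φ (g • ε'), m) at hw
    change g • m' = m
    rw [← D.Ad_smul_hd (φ (g • ε')) m, ← hw, h₂, hφ, D.hd_smul, mul_smul, inv_smul_smul,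
      mul_smul, D.Ad_smul_hd]
  · rintro ⟨g, hg⟩
    obtain ⟨rfl, rfl⟩ := Prod.ext_iff.1 hg
    refine Prod.ext (Quotient.sound ⟨g, ?_⟩) (Quotient.sound ⟨g, rfl⟩)
    simp [ConjPair.smul_def, hφ, D.Ad_smul_smul]

end Upsilon

/-- Two surjections with the same fibres differ by a unique bijection of their codomains. -/
theorem Function.Surjective.existsUnique_bijective_comp_eq {α β γ : Type*} {f : α → β} {g : α → γ}
    (hf : Function.Surjective f) (hg : Function.Surjective g)
    (hfg : ∀ a b, f a = f b ↔ g a = g b) :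
    ∃! F : β → γ, Function.Bijective F ∧ F ∘ f = g := by
  have hF : ∀ a, g (Function.surjInv hf (f a)) = g a := fun a =>
    (hfg _ _).1 (Function.surjInv_eq hf (f a))
  refine ⟨fun b => g (Function.surjInv hf b), ⟨⟨?_, ?_⟩, funext hF⟩, ?_⟩
  · intro b c h
    simpa only [Function.surjInv_eq] using (hfg _ _).2 h
  · intro c
    obtain ⟨a, rfl⟩ := hg c
    exact ⟨f a, hF a⟩
  · rintro F ⟨-, hFf⟩
    exact hf.injective_comp_right (hFf.trans (funext hF).symm)

/-- For two discrete connections `Hor₁`, `Hor₂` on the `G`-set `M`, there is a unique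
bijection `F : G̃_E × (M/G) → G̃_E × (M/G)` with `F ∘ Υ₁ = Υ₂`. -/
theorem upsilon_compare_connections {G E M : Type*} [Group G] [MulAction G E] [MulAction G M]
    (φ : E → M) (hφ : ∀ (g : G) (ε : E), φ (g • ε) = g • φ ε)
    (D₁ D₂ : DiscreteConnection G M) :
    ∃! F : Quotient (MulAction.orbitRel G (ConjPair E G)) × Quotient (MulAction.orbitRel G M) →
        Quotient (MulAction.orbitRel G (ConjPair E G)) × Quotient (MulAction.orbitRel G M),
      Function.Bijective F ∧ F ∘ Upsilon φ D₁ = Upsilon φ D₂ :=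
  (Upsilon_surjective φ D₁).existsUnique_bijective_comp_eq (Upsilon_surjective φ D₂)
    fun p q => (Upsilon_eq_iff hφ D₁ p q).trans (Upsilon_eq_iff hφ D₂ p q).symm
end

section
/- Let G be a group acting on the left on a set Q, let H ⊆ G be a normal subgroup, let U ⊆ Q × Q be invariant under the diagonal G-action, and let Hor ⊆ U be a subset such that for every (q₀, q₁) ∈ U there is a unique h ∈ H with (q₀, h⁻¹ • q₁) ∈ Hor; let Ad : U → H send (q₀, q₁) to this h. Then the following are equivalent: (1) Ad(g • q₀, g • q₁) = g · Ad(q₀, q₁) · g⁻¹ for every g ∈ G and every (q₀, q₁) ∈ U; (2) Hor is invariant under the diagonal G-action, i.e. (q₀, q₁) ∈ Hor implies (g • q₀, g • q₁) ∈ Hor for all g ∈ G. -/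
/-- For a partial discrete connection with structure group a normal subgroup `H ⊆ G` and
`G`-invariant domain `U`, the connection form `Ad` is `G`-equivariant (for the conjugation
action on `H`) if and only if the horizontal submanifold `Hor` is invariant under the
diagonal `G`-action. -/
theorem Ad_conj_equivariant_iff_hor_invariant {G Q : Type*} [Group G] [MulAction G Q]
    (H : Subgroup G) (hH : H.Normal)
    (U : Set (Q × Q))
    (hU : ∀ (g : G) (q₀ q₁ : Q), (q₀, q₁) ∈ U → (g • q₀, g • q₁) ∈ U)
    (Hor : Set (Q × Q)) (hHorU : Hor ⊆ U)
    (Ad : Q × Q → G)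
    (hAdmem : ∀ p ∈ U, Ad p ∈ H)
    (hAd : ∀ p ∈ U, (p.1, (Ad p)⁻¹ • p.2) ∈ Hor)
    (hAduniq : ∀ p ∈ U, ∀ h ∈ H, (p.1, h⁻¹ • p.2) ∈ Hor → h = Ad p) :
    (∀ (g : G) (q₀ q₁ : Q), (q₀, q₁) ∈ U →
        Ad (g • q₀, g • q₁) = g * Ad (q₀, q₁) * g⁻¹) ↔
    (∀ (g : G) (q₀ q₁ : Q), (q₀, q₁) ∈ Hor → (g • q₀, g • q₁) ∈ Hor) := by
  constructor
  · intro hequiv g q₀ q₁ hq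
    have hone : Ad (q₀, q₁) = 1 :=
      (hAduniq _ (hHorU hq) 1 H.one_mem (by simpa using hq)).symm
    have hg : Ad (g • q₀, g • q₁) = 1 := by simp [hequiv g q₀ q₁ (hHorU hq), hone]
    simpa [hg] using hAd _ (hU g q₀ q₁ (hHorU hq))
  · intro hinv g q₀ q₁ hq
    refine (hAduniq _ (hU g q₀ q₁ hq) _ (hH.conj_mem _ (hAdmem _ hq) g) ?_).symm
    simpa [smul_smul, mul_assoc] using hinv g _ _ (hAd _ hq)
end

section
/- Let h ∈ ℝ, h ≠ 0, and let V : ℝ → ℝ be differentiable. Define L : (ℂ × ℂ) × ℂ → ℝ by L((r₀, z₀), r₁) := (1/(2h))(2‖z₀‖² + ‖r₁ − r₀‖²) − (h/2)·V(2‖r₀‖²), with ℂ regarded as a real normed space. Let r_{k−1}, r_k, r_{k+1} ∈ ℂ and z_{k−1}, z_k ∈ ℂ. Then the discrete Lagrange–Poincaré equation, namely: for all (b, c) ∈ ℂ × ℂ, D₁L((r_k, z_k), r_{k+1})(b, c) + D₂L((r_{k−1}, z_{k−1}), r_k)(b) + D₁L((r_{k−1}, z_{k−1}), r_k)(0, −c)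 = 0, holds if and only if z_k = z_{k−1} and r_{k+1} = 2r_k − r_{k−1} − 2h²·V′(2‖r_k‖²)·r_k. -/
open Complex

/-- The reduced discrete Lagrangian of the planar two-particle system:
`L((r₀, z₀), r₁) = (1/(2h))(2‖z₀‖² + ‖r₁ − r₀‖²) − (h/2)·V(2‖r₀‖²)`. -/
noncomputable def reducedLagrangian (h : ℝ) (V : ℝ → ℝ) (p : (ℂ × ℂ) × ℂ) : ℝ :=
  (1 / (2 * h)) * (2 * ‖p.1.2‖ ^ 2 + ‖p.2 - p.1.1‖ ^ 2) - (h / 2) * V (2 * ‖p.1.1‖ ^ 2)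

open scoped RealInnerProductSpace in
/-- The total derivative of the reduced discrete Lagrangian. -/
theorem fderiv_reducedLagrangian_apply {h : ℝ} (hh : h ≠ 0) {V : ℝ → ℝ}
    (hV : Differentiable ℝ V) (r₀ z₀ r₁ b c d : ℂ) :
    fderiv ℝ (reducedLagrangian h V) ((r₀, z₀), r₁) ((b, c), d)
      = h⁻¹ * (2 * ⟪z₀, c⟫ + ⟪r₁ - r₀, d - b⟫)
        - 2 * h * deriv V (2 * ‖r₀‖ ^ 2) * ⟪r₀, b⟫ := by
  have hid := hasFDerivAt_id (𝕜 := ℝ) ((r₀, z₀), r₁)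
  have hr₀ := hid.fst.fst
  have hz₀ := hid.fst.snd
  have hr₁ := hid.snd
  have hpot := (hV (2 * ‖r₀‖ ^ 2)).hasDerivAt.comp_hasFDerivAt ((r₀, z₀), r₁)
    (hr₀.norm_sq.const_mul 2)
  have hkin := ((hz₀.norm_sq.const_mul 2).add (hr₁.sub hr₀).norm_sq).const_mul (1 / (2 * h))
  have hL : HasFDerivAt (reducedLagrangian h V) _ ((r₀, z₀), r₁) :=
    hkin.sub (hpot.const_mul (h / 2))
  rw [hL.fderiv]
  simp [-Complex.inner, inner_sub_left, inner_sub_right]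
  field_simp

/-- Equations of motion of the reduced system: the discrete Lagrange–Poincaré equation
(with chaining map `(b, c) ↦ (0, −c)`) holds at `((r_{k−1}, z_{k−1}), r_k)`,
`((r_k, z_k), r_{k+1})` if and only if `z_k = z_{k−1}` and
`r_{k+1} = 2 r_k − r_{k−1} − 2 h² V′(2‖r_k‖²) r_k`. -/
theorem reduced_equations_of_motion (h : ℝ) (hh : h ≠ 0) (V : ℝ → ℝ)
    (hV : Differentiable ℝ V) (rkm rk rkp zkm zk : ℂ) :
    (∀ b c : ℂ,
        fderiv ℝ (reducedLagrangian h V) ((rk, zk), rkp) ((b, c), 0)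
        + fderiv ℝ (reducedLagrangian h V) ((rkm, zkm), rk) ((0, 0), b)
        + fderiv ℝ (reducedLagrangian h V) ((rkm, zkm), rk) ((0, -c), 0) = 0)
    ↔ (zk = zkm ∧
        rkp = 2 * rk - rkm - 2 * (h : ℂ) ^ 2 * ((deriv V (2 * ‖rk‖ ^ 2) : ℝ) : ℂ) * rk) := by
  have key (b c : ℂ) :
      fderiv ℝ (reducedLagrangian h V) ((rk, zk), rkp) ((b, c), 0)
        + fderiv ℝ (reducedLagrangian h V) ((rkm, zkm), rk) ((0, 0), b)
        + fderiv ℝ (reducedLagrangian h V) ((rkm, zkm), rk) ((0, -c), 0)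
      = h⁻¹ * (2 * inner ℝ (zk - zkm) c + inner ℝ (2 * rk - rkm
          - 2 * (h : ℂ) ^ 2 * ((deriv V (2 * ‖rk‖ ^ 2) : ℝ) : ℂ) * rk - rkp) b) := by
    have hsmul : 2 * rk - rkm - 2 * (h : ℂ) ^ 2 * ((deriv V (2 * ‖rk‖ ^ 2) : ℝ) : ℂ) * rk - rkp
        = (rk - rkm) - (rkp - rk) - (2 * h ^ 2 * deriv V (2 * ‖rk‖ ^ 2)) • rk := by
      rw [Complex.real_smul]
      push_cast
      ring
    simp only [hsmul, fderiv_reducedLagrangian_apply hh hV, inner_sub_left (𝕜 := ℝ),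
      inner_sub_right (𝕜 := ℝ), real_inner_smul_left, inner_zero_right, inner_neg_right]
    field_simp
    ring
  simp only [key, mul_eq_zero, inv_eq_zero, hh, false_or]
  constructor
  · intro H
    constructor
    · have hz := H 0 (zk - zkm)
      rw [inner_zero_right, add_zero, mul_eq_zero_iff_left two_ne_zero, inner_self_eq_zero] at hz
      exact sub_eq_zero.mp hz
    · have hr := H (2 * rk - rkm
        - 2 * (h : ℂ) ^ 2 * ((deriv V (2 * ‖rk‖ ^ 2) : ℝ) : ℂ) * rk - rkp) 0
      rw [inner_zero_right, mul_zero, zero_add, inner_self_eq_zero] at hr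
      exact (sub_eq_zero.mp hr).symm
  · rintro ⟨hz, hr⟩ b c
    rw [sub_eq_zero.mpr hz, sub_eq_zero.mpr hr.symm]
    simp only [inner_zero_left, mul_zero, add_zero]
end

section
/- Let Q be a real normed vector space, L : Q × Q → ℝ Fréchet differentiable, and N ≥ 2. A finite sequence q₀, q₁, …, q_N in Q satisfies Σ_{k=0}^{N−1} DL(q_k, q_{k+1})(δq_k, δq_{k+1}) = 0 for every choice of variations δq₀, …, δq_N ∈ Q with δq₀ = 0 and δq_N = 0, if and only if it satisfies the discrete Euler–Lagrange equations D₁L(q_k, q_{k+1}) + D₂L(q_{k−1}, q_k) = 0 (as continuous linear functionals on Q) for every k = 1, …, N−1. -/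
/-- Discrete integration by parts for a sum of functionals along consecutive pairs. -/
theorem sum_apply_consecutive_eq {Q : Type*} [NormedAddCommGroup Q] [NormedSpace ℝ Q]
    (A : ℕ → Q × Q →L[ℝ] ℝ) (v : ℕ → Q) (n : ℕ) :
    ∑ k ∈ Finset.range (n + 1), A k (v k, v (k + 1)) =
      A 0 (v 0, 0)
      + ∑ k ∈ Finset.range n,
          ((A (k + 1)).comp (ContinuousLinearMap.inl ℝ Q Q)
            + (A k).comp (ContinuousLinearMap.inr ℝ Q Q)) (v (k + 1))
      + A n (0, v (n + 1)) := by
  have split (k : ℕ) : A k (v k, v (k + 1)) = A k (v k, 0) + A k (0, v (k + 1)) := by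
    simp [← map_add]
  induction n with
  | zero => simp [← map_add]
  | succ n ih =>
    rw [Finset.sum_range_succ, ih, Finset.sum_range_succ, split (n + 1)]
    simp only [add_apply, ContinuousLinearMap.comp_apply,
      ContinuousLinearMap.inl_apply, ContinuousLinearMap.inr_apply]
    ring


/-- Discrete Hamilton's principle for a discrete mechanical system `(Q, L)`: a discrete
path `q₀, …, q_N` is critical for the discrete action among variations vanishing at the
endpoints if and only if it satisfies the discrete Euler–Lagrange equations
`D₁L(q_k, q_{k+1}) + D₂L(q_{k−1}, q_k) = 0` for `k = 1, …, N−1`. -/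
theorem discrete_euler_lagrange {Q : Type*} [NormedAddCommGroup Q] [NormedSpace ℝ Q]
    (L : Q × Q → ℝ) (hL : Differentiable ℝ L)
    (N : ℕ) (hN : 2 ≤ N) (q : ℕ → Q) :
    (∀ δq : ℕ → Q, δq 0 = 0 → δq N = 0 →
        ∑ k ∈ Finset.range N, fderiv ℝ L (q k, q (k + 1)) (δq k, δq (k + 1)) = 0)
    ↔
    (∀ k, 1 ≤ k → k ≤ N - 1 →
      (fderiv ℝ L (q k, q (k + 1))).comp (ContinuousLinearMap.inl ℝ Q Q)
      + (fderiv ℝ L (q (k - 1), q k)).comp (ContinuousLinearMap.inr ℝ Q Q) = 0) := by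
  obtain ⟨n, rfl⟩ : ∃ n, N = n + 1 := ⟨N - 1, by omega⟩
  have parts (v : ℕ → Q) := sum_apply_consecutive_eq (fun k => fderiv ℝ L (q k, q (k + 1))) v n
  constructor
  · intro h k hk hkn
    obtain ⟨j, rfl⟩ : ∃ j, k = j + 1 := ⟨k - 1, by omega⟩
    have hj : j < n := by omega
    ext w
    have single_eq_zero (i : ℕ) (hi : i ≠ j + 1) : (Pi.single (j + 1) w : ℕ → Q) i = 0 :=
      Pi.single_eq_of_ne (M := fun _ => Q) hi w
    have hw := h (Pi.single (j + 1) w) (single_eq_zero _ (by omega)) (single_eq_zero _ (by omega))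
    rw [parts, Finset.sum_eq_single_of_mem j (Finset.mem_range.mpr hj)] at hw
    · rw [single_eq_zero 0 (by omega),
        single_eq_zero (n + 1) (by omega), Prod.mk_zero_zero] at hw
      simpa using hw
    · intro i _ hij
      rw [single_eq_zero (i + 1) (by omega), map_zero]
  · intro h v h0 hN'
    rw [parts, h0, hN', Finset.sum_eq_zero]
    · simp only [Prod.mk_zero_zero, map_zero, add_zero]
    · intro k hk
      have hk' := Finset.mem_range.mp hk
      have := h (k + 1) (by omega) (by omega)
      rw [Nat.add_sub_cancel] at this
      rw [this, zero_apply]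
end
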